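/- Let E₁, E₂ be Banach spaces, 1 ≤ p < 2, X ∈ V^p([0,T],E₂), and f : E₁ → L(E₂,E₁) γ-Hölder with 1 + γ > p. Let Φ : E₁ → E₁ be twice continuously differentiable with f(Φ(y)) = DΦ(y) ∘ f(y) in L(E₂,E₁) for all y ∈ E₁. Then Φ is a symmetry of the Young equation dY = f(Y)dX: for every solution Y starting at y₀, the path Φ ∘ Y is a solution starting at Φ(y₀), i.e. Φ(Y_t) = Φ(y₀) + ∫_0^t f(Φ(Y_s)) dX_s for all t ∈ [0,T]. -/

import Mathlib

open Set Filter Topology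

noncomputable section

/-- The `p`-variation of a path `X : ℝ → E` on the interval `[a,b]`,
`‖X‖_{p,[a,b]} = (sup_D Σ_i ‖X_{t_{i+1}} − X_{t_i}‖^p)^(1/p)`, the supremum being taken
over all finite partitions `a = t₀ ≤ t₁ ≤ … ≤ t_k = b`. -/
def pVar {E : Type*} [NormedAddCommGroup E] (p : ℝ) (X : ℝ → E) (a b : ℝ) : ENNReal :=
  ⨆ (k : ℕ) (t : Fin (k + 1) → ℝ)
    (_ : Monotone t ∧ t 0 = a ∧ t (Fin.last k) = b),
    (∑ i : Fin k, (‖X (t i.succ) - X (t i.castSucc)‖₊ : ENNReal) ^ p) ^ (1 / p)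

/-- `X ∈ V^p([a,b],E)`: `X` is continuous on `[a,b]` and has finite `p`-variation there. -/
def MemVp {E : Type*} [NormedAddCommGroup E] (p : ℝ) (X : ℝ → E) (a b : ℝ) : Prop :=
  ContinuousOn X (Set.Icc a b) ∧ pVar p X a b < ⊤

/-- A partition `a = t₀ ≤ t₁ ≤ … ≤ t_k = b` of `[a,b]`. -/
structure YoungPartition (a b : ℝ) where
  k : ℕ
  t : Fin (k + 1) → ℝ
  mono : Monotone t
  first : t 0 = a
  last : t (Fin.last k) = b

/-- The mesh of a partition. -/
def YoungPartition.mesh {a b : ℝ} (D : YoungPartition a b) : ℝ :=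
  ⨆ i : Fin D.k, (D.t i.succ - D.t i.castSucc)

/-- The Riemann sum `Σ_i Z_{t_i}(X_{t_{i+1}} − X_{t_i})` along a partition. -/
def riemannSum {E F : Type*} [NormedAddCommGroup E] [NormedSpace ℝ E]
    [NormedAddCommGroup F] [NormedSpace ℝ F]
    (Z : ℝ → E →L[ℝ] F) (X : ℝ → E) {a b : ℝ} (D : YoungPartition a b) : F :=
  ∑ i : Fin D.k, Z (D.t i.castSucc) (X (D.t i.succ) - X (D.t i.castSucc))

/-- `IsYoungIntegral Z X a b I` : the Riemann sums of `Z` against `X` over partitions of `[a,b]`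
converge to `I` as the mesh tends to `0`; i.e. the Young integral `∫_a^b Z dX` exists and
equals `I`. -/
def IsYoungIntegral {E F : Type*} [NormedAddCommGroup E] [NormedSpace ℝ E]
    [NormedAddCommGroup F] [NormedSpace ℝ F]
    (Z : ℝ → E →L[ℝ] F) (X : ℝ → E) (a b : ℝ) (I : F) : Prop :=
  Filter.Tendsto (fun D : YoungPartition a b => riemannSum Z X D)
    (Filter.comap YoungPartition.mesh (nhds 0)) (nhds I)

/-- View a vector `v : E` as the continuous linear map `ℝ →L[ℝ] E`, `c ↦ c • v`; used to
integrate vector-valued integrands against scalar integrators. -/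
def toCLM {E : Type*} [NormedAddCommGroup E] [NormedSpace ℝ E] (v : E) : ℝ →L[ℝ] E :=
  (1 : ℝ →L[ℝ] ℝ).smulRight v

/-- The `α`-Hölder seminorm `‖X‖_{α;H} = sup_{s ≠ t ∈ [a,b]} ‖X_t − X_s‖ / |t−s|^α` of a path. -/
def holderSemiPath {E : Type*} [NormedAddCommGroup E] (α : ℝ) (X : ℝ → E) (a b : ℝ) : ENNReal :=
  ⨆ (s : Set.Icc a b) (t : Set.Icc a b) (_ : (s : ℝ) ≠ (t : ℝ)),
    (‖X (t : ℝ) - X (s : ℝ)‖₊ : ENNReal) / edist (s : ℝ) (t : ℝ) ^ α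

/-- The `α`-Hölder norm (sup norm plus Hölder seminorm) of a path on `[a,b]`. -/
def holderNormPath {E : Type*} [NormedAddCommGroup E] (α : ℝ) (X : ℝ → E) (a b : ℝ) : ENNReal :=
  (⨆ t : Set.Icc a b, (‖X (t : ℝ)‖₊ : ENNReal)) + holderSemiPath α X a b

/-- The `γ`-Hölder constant `‖f‖_{γ,H} = sup_{x ≠ y} ‖f x − f y‖ / ‖x − y‖^γ` of a map
between normed spaces. -/
def holderConst {E F : Type*} [NormedAddCommGroup E] [NormedAddCommGroup F]
    (γ : ℝ) (f : E → F) : ENNReal :=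
  ⨆ (x : E) (y : E) (_ : x ≠ y), (‖f x - f y‖₊ : ENNReal) / (‖x - y‖₊ : ENNReal) ^ γ
/-- `Y` is a solution on `[0,T]` of the Young equation `dY = Σ_{i=1}^n f_i(Y) dX^i`
starting at `y₀`, where `f_i(y) = f(y)(e_i)` for the standard basis `e_i` of `ℝ^n` and
`X^i` are the coordinates of `X`: `Y ∈ V^p([0,T],E₁)` and
`Y_t = y₀ + Σ_i ∫_0^t f_i(Y_s) dX^i_s` (Young integrals). -/
def IsYoungSolution {n : ℕ} {E₁ : Type*} [NormedAddCommGroup E₁] [NormedSpace ℝ E₁]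
    (p T : ℝ) (X : ℝ → Fin n → ℝ) (f : E₁ → (Fin n → ℝ) →L[ℝ] E₁)
    (y₀ : E₁) (Y : ℝ → E₁) : Prop :=
  Y 0 = y₀ ∧ MemVp p Y 0 T ∧
  ∀ t ∈ Set.Icc (0 : ℝ) T, ∃ I : Fin n → E₁,
    (∀ i, IsYoungIntegral (fun s => toCLM (f (Y s) (Pi.single i 1)))
      (fun s => X s i) 0 t (I i)) ∧
    Y t = y₀ + ∑ i, I i

/-- The sum `∑ F tᵢ tᵢ₊₁` over consecutive entries of a list. -/
def csum {G : Type*} [AddMonoid G] (F : ℝ → ℝ → G) : List ℝ → G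
  | [] => 0
  | [_] => 0
  | a :: b :: l => F a b + csum F (b :: l)

section csum

variable {G : Type*} (F : ℝ → ℝ → G)

@[simp] theorem csum_nil [AddMonoid G] : csum F [] = 0 := rfl

@[simp] theorem csum_singleton [AddMonoid G] (a : ℝ) : csum F [a] = 0 := rfl

@[simp] theorem csum_cons_cons [AddMonoid G] (a b : ℝ) (l : List ℝ) :
    csum F (a :: b :: l) = F a b + csum F (b :: l) := rfl

theorem csum_append_cons [AddMonoid G] (l₁ : List ℝ) (a : ℝ) (l₂ : List ℝ) :
    csum F (l₁ ++ a :: l₂) = csum F (l₁ ++ [a]) + csum F (a :: l₂) := by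
  induction l₁ with
  | nil => simp
  | cons x l ih => cases l <;> simp_all [add_assoc]

theorem csum_ofFn [AddCommMonoid G] {k : ℕ} (t : Fin (k + 1) → ℝ) :
    csum F (List.ofFn t) = ∑ i : Fin k, F (t i.castSucc) (t i.succ) := by
  induction k with
  | zero => simp
  | succ k ih =>
    have := ih (fun i => t i.succ)
    rw [List.ofFn_succ] at this ⊢
    rw [List.ofFn_succ, csum_cons_cons, this, Fin.sum_univ_succ]
    rfl

theorem csum_add_le_append {F : ℝ → ℝ → ℝ} (hF : ∀ a b, 0 ≤ F a b) (l₁ l₂ : List ℝ) :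
    csum F l₁ + csum F l₂ ≤ csum F (l₁ ++ l₂) := by
  induction l₁ with
  | nil => simp
  | cons x l ih =>
    cases l with
    | nil => cases l₂ <;> simp [hF]
    | cons y l => simp only [List.cons_append, csum_cons_cons] at ih ⊢; linarith

theorem csum_add {F F' : ℝ → ℝ → ℝ} (l : List ℝ) :
    csum (fun a b => F a b + F' a b) l = csum F l + csum F' l := by
  induction l with
  | nil => simp
  | cons x l ih =>
    cases l with
    | nil => simp
    | cons y l => simp only [csum_cons_cons, ih]; ring

/-- If each `F a b` approximates an increment of `h` up to a superadditive error `ω a b`, then so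
does the sum of `F` along a subdivision. -/
theorem norm_csum_sub_le [SeminormedAddCommGroup G] {F : ℝ → ℝ → G} {h : ℝ → G}
    {ω : ℝ → ℝ → ℝ} {R : ℝ → ℝ → Prop} {A B : ℝ} (hω0 : ∀ a ∈ Icc A B, 0 ≤ ω a a)
    (hω : ∀ a b c, A ≤ a → a ≤ b → b ≤ c → c ≤ B → ω a b + ω b c ≤ ω a c)
    (hR : ∀ a b, R a b → a ≤ b)
    (hF : ∀ a b, A ≤ a → b ≤ B → R a b → ‖F a b - (h b - h a)‖ ≤ ω a b)
    {l : List ℝ} {a b : ℝ} (hl : (a :: l).IsChain R) (hb : (a :: l).getLast? = some b)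
    (ha : A ≤ a) (hB : b ≤ B) :
    a ≤ b ∧ ‖csum F (a :: l) - (h b - h a)‖ ≤ ω a b := by
  induction l generalizing a with
  | nil =>
    obtain rfl : a = b := by simpa using hb
    simpa using hω0 a ⟨ha, hB⟩
  | cons x l ih =>
    rw [List.isChain_cons_cons] at hl
    have hax := hR _ _ hl.1
    obtain ⟨hxb, h1⟩ := ih hl.2 (by simpa using hb) (ha.trans hax)
    refine ⟨hax.trans hxb, ?_⟩
    have h2 := hF a x ha (hxb.trans hB) hl.1
    have h3 := hω a x b ha hax hxb hB
    calc ‖csum F (a :: x :: l) - (h b - h a)‖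
        = ‖(F a x - (h x - h a)) + (csum F (x :: l) - (h b - h x))‖ := by
          rw [csum_cons_cons]; congr 1; abel
      _ ≤ _ := (norm_add_le _ _).trans (by linarith)

/-- Some interior entry of the list contributes at most the average. -/
theorem exists_removable {F : ℝ → ℝ → ℝ} (hF : ∀ a b, 0 ≤ F a b) (F' : ℝ → ℝ → ℝ) (a b c : ℝ) (l : List ℝ) :
    ∃ l₁ x y z l₂, a :: b :: c :: l = l₁ ++ x :: y :: z :: l₂ ∧
      (l.length + 1) * (F x y + F' y z) ≤ csum F (a :: b :: c :: l) + csum F' (b :: c :: l) := by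
  induction l generalizing a b c with
  | nil => exact ⟨[], a, b, c, [], rfl, by simp; linarith [hF b c]⟩
  | cons d l ih =>
    obtain ⟨l₁, x, y, z, l₂, he, hle⟩ := ih b c d
    have hc : csum F (a :: b :: c :: d :: l) + csum F' (b :: c :: d :: l) =
        (F a b + F' b c) + (csum F (b :: c :: d :: l) + csum F' (c :: d :: l)) := by
      rw [csum_cons_cons F a, csum_cons_cons F' b]; ring
    rw [hc]
    push_cast [List.length_cons]
    rcases le_total (F x y + F' y z) (F a b + F' b c) with h | h
    · exact ⟨a :: l₁, x, y, z, l₂, by simp [he], by linarith⟩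
    · refine ⟨[], a, b, c, d :: l, rfl, ?_⟩
      have := mul_le_mul_of_nonneg_left h (by positivity : (0 : ℝ) ≤ l.length + 1)
      linarith

end csum

/-- Young's maximal inequality: removing points one at a time compares a Riemann sum with its
one-step approximation. -/
theorem norm_riemann_sub_le {E G : Type*} [NormedAddCommGroup E] [NormedSpace ℝ E]
    [NormedAddCommGroup G] [NormedSpace ℝ G] {Z : ℝ → E →L[ℝ] G} {X : ℝ → E}
    {F F' : ℝ → ℝ → ℝ} {A V θ s t : ℝ} (hθ : 1 < θ) (hA0 : 0 ≤ A)
    (hF : ∀ a b, 0 ≤ F a b) (hF' : ∀ a b, 0 ≤ F' a b)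
    (hA : ∀ x y z, x ∈ Icc s t → y ∈ Icc s t → z ∈ Icc s t →
      ‖(Z y - Z x) (X z - X y)‖ ≤ A * (F x y + F' y z) ^ θ)
    (hV : ∀ l : List ℝ, l.Pairwise (· ≤ ·) → (∀ x ∈ l, x ∈ Icc s t) →
      csum F l + csum F' l ≤ V)
    {l : List ℝ} {a b : ℝ} (hl : l.Pairwise (· ≤ ·)) (hlm : ∀ x ∈ l, x ∈ Icc s t)
    (ha : l.head? = some a) (hb : l.getLast? = some b) :
    ‖csum (fun x y => Z x (X y - X x)) l - Z a (X b - X a)‖ ≤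
      A * V ^ θ * ∑' j : ℕ, 1 / ((j : ℝ) + 1) ^ θ := by
  have hsum : Summable fun j : ℕ => 1 / ((j : ℝ) + 1) ^ θ := by
    have := (summable_nat_add_iff 1).2 (Real.summable_one_div_nat_rpow.2 hθ)
    simpa using this
  have hnn : ∀ j : ℕ, 0 ≤ 1 / ((j : ℝ) + 1) ^ θ := fun j => by positivity
  have hV0 : 0 ≤ V := by simpa using hV [] (by simp) (by simp)
  have hAV : 0 ≤ A * V ^ θ := by positivity
  suffices H : ∀ (n : ℕ) (l : List ℝ), l.length = n + 2 → l.Pairwise (· ≤ ·) →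
      (∀ x ∈ l, x ∈ Icc s t) → l.head? = some a → l.getLast? = some b →
      ‖csum (fun x y => Z x (X y - X x)) l - Z a (X b - X a)‖ ≤
        A * V ^ θ * ∑ j ∈ Finset.range n, 1 / ((j : ℝ) + 1) ^ θ by
    match l, hl, hlm, ha, hb with
    | [], _, _, ha, _ => simp at ha
    | [x], _, _, ha, hb =>
      obtain rfl : x = a := by simpa using ha
      obtain rfl : x = b := by simpa using hb
      simpa using mul_nonneg hAV (tsum_nonneg hnn)
    | x :: y :: l, hl, hlm, ha, hb =>
      refine (H l.length _ rfl hl hlm ha hb).trans ?_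
      gcongr
      exact hsum.sum_le_tsum _ fun j _ => hnn j
  intro n
  induction n with
  | zero =>
    intro l hn hl hlm ha hb
    match l, hn with
    | [x, y], _ =>
      obtain rfl : x = a := by simpa using ha
      obtain rfl : y = b := by simpa using hb
      simp
  | succ n ih =>
    intro l hn hl hlm ha hb
    match l, hn with
    | u :: v :: w :: l, hn =>
      obtain ⟨l₁, x, y, z, l₂, he, hle⟩ := exists_removable hF F' u v w l
      have hlen : l.length = n := by simpa using hn
      have hVl := hV _ hl hlm
      rw [csum_cons_cons F'] at hVl
      have hg : F x y + F' y z ≤ V / (n + 1) := by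
        rw [le_div_iff₀ (by positivity), ← hlen]
        linarith [hF' u v]
      rw [he] at hn hl hlm ha hb ⊢
      have hsub : (l₁ ++ x :: z :: l₂).Sublist (l₁ ++ x :: y :: z :: l₂) := by simp
      have h1 := ih (l₁ ++ x :: z :: l₂) (by simp at hn ⊢; omega) (hl.sublist hsub)
        (fun q hq => hlm q (hsub.subset hq))
        (by cases l₁ <;> simpa using ha) (by simpa using hb)
      have h2 := hA x y z (hlm x (by simp)) (hlm y (by simp)) (hlm z (by simp))
      have h3 : A * (F x y + F' y z) ^ θ ≤ A * V ^ θ * (1 / ((n : ℝ) + 1) ^ θ) := by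
        rw [mul_assoc, mul_one_div, ← Real.div_rpow hV0 (by positivity)]
        have := hF x y
        have := hF' y z
        gcongr
      have h4 : csum (fun x y => Z x (X y - X x)) (l₁ ++ x :: y :: z :: l₂) =
          csum (fun x y => Z x (X y - X x)) (l₁ ++ x :: z :: l₂) +
            (Z y - Z x) (X z - X y) := by
        rw [csum_append_cons _ _ x (y :: _), csum_append_cons _ _ x (z :: _)]
        simp only [csum_cons_cons, map_sub, sub_apply]
        abel
      rw [h4, Finset.sum_range_succ, mul_add, add_sub_right_comm]
      exact (norm_add_le _ _).trans (add_le_add h1 (h2.trans h3))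

/-- `y` lies to the right of `x`, at distance at most `δ`. -/
def MeshStep (δ x y : ℝ) : Prop := x ≤ y ∧ y - x ≤ δ

theorem pairwise_le_of_isChain_meshStep {δ : ℝ} {l : List ℝ} (hl : l.IsChain (MeshStep δ)) :
    l.Pairwise (· ≤ ·) :=
  List.isChain_iff_pairwise.1 (hl.imp fun _ _ h => h.1)

theorem le_of_mem_of_getLast? {l : List ℝ} {b x : ℝ} (hl : l.Pairwise (· ≤ ·))
    (hb : l.getLast? = some b) (hx : x ∈ l) : x ≤ b := by
  obtain ⟨l', rfl⟩ := List.getLast?_eq_some_iff.1 hb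
  rw [List.pairwise_append] at hl
  rcases List.mem_append.1 hx with h | h
  · exact hl.2.2 x h b (by simp)
  · exact (List.mem_singleton.1 h).le

theorem mem_Icc_of_mem_cons {l : List ℝ} {a b : ℝ} (hl : (a :: l).Pairwise (· ≤ ·))
    (hb : (a :: l).getLast? = some b) : ∀ x ∈ a :: l, x ∈ Icc a b := fun _ hx =>
  ⟨(List.mem_cons.1 hx).elim (fun h => h.ge) (List.rel_of_pairwise_cons hl),
    le_of_mem_of_getLast? hl hb hx⟩

theorem exists_isChain_meshStep {δ a b : ℝ} (hδ : 0 < δ) (hab : a ≤ b) :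
    ∃ l : List ℝ, (a :: l).IsChain (MeshStep δ) ∧ (a :: l).getLast? = some b := by
  obtain ⟨n, hn⟩ := exists_nat_ge ((b - a) / δ)
  rw [div_le_iff₀ hδ] at hn
  induction n generalizing a with
  | zero =>
    obtain rfl : a = b := by simp at hn; linarith
    exact ⟨[], by simp, by simp⟩
  | succ n ih =>
    push_cast at hn
    obtain ⟨l, h1, h2⟩ := ih (a := min (a + δ) b) (min_le_right _ _) (by
      rcases min_cases (a + δ) b with h | h
      · rw [h.1]; linarith
      · rw [h.1, sub_self]; positivity)
    refine ⟨_ :: l, List.isChain_cons_cons.2 ⟨⟨le_min (by linarith) hab, ?_⟩, h1⟩, by simpa using h2⟩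
    linarith [min_le_left (a + δ) b]

theorem exists_ofFn_eq (a : ℝ) (l : List ℝ) :
    ∃ t : Fin (l.length + 1) → ℝ, List.ofFn t = a :: l :=
  ⟨(a :: l).get, List.ofFn_get (a :: l)⟩

theorem apply_last_of_getLast?_ofFn {k : ℕ} {t : Fin (k + 1) → ℝ} {b : ℝ}
    (h : (List.ofFn t).getLast? = some b) : t (Fin.last k) = b := by
  rw [List.getLast?_eq_getLast_of_ne_nil (by simp), List.getLast_ofFn_succ] at h
  simpa using h

theorem meshStep_mesh {a b : ℝ} (D : YoungPartition a b) (i : Fin D.k) :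
    MeshStep D.mesh (D.t i.castSucc) (D.t i.succ) :=
  ⟨D.mono i.castSucc_lt_succ.le,
    le_ciSup (f := fun i : Fin D.k => D.t i.succ - D.t i.castSucc) (Set.finite_range _).bddAbove i⟩

theorem isChain_ofFn_succ {R : ℝ → ℝ → Prop} {k : ℕ} {t : Fin (k + 1) → ℝ} :
    (List.ofFn t).IsChain R ↔ ∀ i : Fin k, R (t i.castSucc) (t i.succ) := by
  rw [List.isChain_ofFn]
  exact ⟨fun h i => h i (by omega), fun h i hi => h ⟨i, by omega⟩⟩

theorem isYoungIntegral_iff_csum {E G : Type*} [NormedAddCommGroup E] [NormedSpace ℝ E]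
    [NormedAddCommGroup G] [NormedSpace ℝ G] {Z : ℝ → E →L[ℝ] G} {X : ℝ → E} {a b : ℝ} {I : G} :
    IsYoungIntegral Z X a b I ↔ ∀ ε > 0, ∃ δ > 0, ∀ l : List ℝ,
      (a :: l).IsChain (MeshStep δ) → (a :: l).getLast? = some b →
      ‖csum (fun x y => Z x (X y - X x)) (a :: l) - I‖ < ε := by
  rw [IsYoungIntegral, (Metric.nhds_basis_ball.comap _).tendsto_iff Metric.nhds_basis_ball]
  refine forall₂_congr fun ε hε => ⟨?_, ?_⟩
  · rintro ⟨δ, hδ, h⟩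
    refine ⟨δ / 2, half_pos hδ, fun l hl hb => ?_⟩
    obtain ⟨t, ht⟩ := exists_ofFn_eq a l
    rw [← ht] at hl hb
    rw [← ht, csum_ofFn]
    rw [isChain_ofFn_succ] at hl
    let D : YoungPartition a b :=
      { k := l.length
        t := t
        mono := Fin.monotone_iff_le_succ.2 fun i => (hl i).1
        first := by rw [List.ofFn_succ] at ht; exact (List.cons.inj ht).1
        last := apply_last_of_getLast?_ofFn hb }
    have hD0 : 0 ≤ D.mesh := Real.iSup_nonneg fun i => sub_nonneg.2 (hl i).1
    have hD1 : D.mesh ≤ δ / 2 := Real.iSup_le (fun i => (hl i).2) (half_pos hδ).le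
    have := h D (by
      simp only [mem_preimage, Metric.mem_ball, dist_zero_right, Real.norm_eq_abs]
      rw [abs_of_nonneg hD0]; linarith)
    rwa [mem_ball_iff_norm] at this
  · rintro ⟨δ, hδ, h⟩
    refine ⟨δ, hδ, fun D hD => ?_⟩
    have hD' : D.mesh < δ := by
      have : |D.mesh| < δ := by simpa using hD
      exact (le_abs_self _).trans_lt this
    have he : List.ofFn D.t = a :: List.ofFn fun i => D.t (Fin.succ i) := by
      rw [List.ofFn_succ, D.first]
    have hl : (List.ofFn D.t).IsChain (MeshStep δ) :=
      isChain_ofFn_succ.2 fun i => ⟨(meshStep_mesh D i).1, (meshStep_mesh D i).2.trans hD'.le⟩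
    have hb : (List.ofFn D.t).getLast? = some b := by
      rw [List.getLast?_eq_getLast_of_ne_nil (by simp), List.getLast_ofFn_succ, D.last]
    rw [he] at hl hb
    rw [mem_ball_iff_norm, riemannSum,
      ← csum_ofFn (fun x y => Z x (X y - X x)), he]
    exact h _ hl hb

/-- Riemann sums over `[s, t]` get arbitrarily close to the difference of the Young integrals
over `[a, t]` and `[a, s]`. -/
theorem IsYoungIntegral.exists_csum_near {E G : Type*} [NormedAddCommGroup E] [NormedSpace ℝ E]
    [NormedAddCommGroup G] [NormedSpace ℝ G] {Z : ℝ → E →L[ℝ] G} {X : ℝ → E} {a s t : ℝ} {I J : G}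
    (hs : IsYoungIntegral Z X a s I) (ht : IsYoungIntegral Z X a t J) (has : a ≤ s) (hst : s ≤ t)
    {ε : ℝ} (hε : 0 < ε) :
    ∃ l : List ℝ, (s :: l).Pairwise (· ≤ ·) ∧ (s :: l).getLast? = some t ∧
      ‖csum (fun x y => Z x (X y - X x)) (s :: l) - (J - I)‖ ≤ ε := by
  obtain ⟨δ₁, hδ₁, h₁⟩ := isYoungIntegral_iff_csum.1 hs (ε / 2) (half_pos hε)
  obtain ⟨δ₂, hδ₂, h₂⟩ := isYoungIntegral_iff_csum.1 ht (ε / 2) (half_pos hε)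
  obtain ⟨l₁, hl₁, hb₁⟩ := exists_isChain_meshStep (lt_min hδ₁ hδ₂) has
  obtain ⟨l₂, hl₂, hb₂⟩ := exists_isChain_meshStep hδ₂ hst
  have h1 := h₁ l₁ (hl₁.imp fun _ _ h => ⟨h.1, h.2.trans (min_le_left _ _)⟩) hb₁
  obtain ⟨l', hl'⟩ := List.getLast?_eq_some_iff.1 hb₁
  have hlast : (l' ++ s :: l₂).getLast? = some t := by simpa using hb₂
  have hchain : (l' ++ s :: l₂).IsChain (MeshStep δ₂) := by
    have := List.IsChain.append_overlap (l₁ := l') (l₂ := [s]) (l₃ := l₂)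
      (hl' ▸ hl₁.imp fun _ _ h => ⟨h.1, h.2.trans (min_le_right _ _)⟩) hl₂ (by simp)
    simpa using this
  obtain ⟨m, hm⟩ : ∃ m, l' ++ s :: l₂ = a :: m := by
    cases l' with
    | nil => exact ⟨l₂, by simp at hl'; simp [hl'.1]⟩
    | cons x l' => exact ⟨l' ++ s :: l₂, by simp at hl'; simp [hl'.1]⟩
  rw [hm] at hlast hchain
  have h2 := h₂ m hchain hlast
  rw [← hm, csum_append_cons, ← hl'] at h2
  refine ⟨l₂, pairwise_le_of_isChain_meshStep hl₂, hb₂, ?_⟩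
  set P := csum (fun x y => Z x (X y - X x)) (a :: l₁)
  set Q := csum (fun x y => Z x (X y - X x)) (s :: l₂)
  calc ‖Q - (J - I)‖ = ‖(P + Q - J) - (P - I)‖ := by congr 1; abel
    _ ≤ ‖P + Q - J‖ + ‖P - I‖ := norm_sub_le _ _
    _ ≤ ε := by linarith

/-- Sums of `H` bounded along subdivisions of `[A, B]` are dominated by a superadditive control. -/
theorem exists_control {H : ℝ → ℝ → ℝ} (hH : ∀ a b, 0 ≤ H a b) {A B M : ℝ}
    (hM : ∀ l : List ℝ, l.Pairwise (· ≤ ·) → (∀ x ∈ l, x ∈ Icc A B) → csum H l ≤ M) :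
    ∃ ω : ℝ → ℝ → ℝ,
      (∀ a b, A ≤ a → b ≤ B → ∀ l : List ℝ, l.Pairwise (· ≤ ·) → (∀ x ∈ l, x ∈ Icc a b) →
        csum H l ≤ ω a b) ∧
      (∀ a b c, A ≤ a → a ≤ b → b ≤ c → c ≤ B → ω a b + ω b c ≤ ω a c) ∧
      ∀ a b, A ≤ a → b ≤ B → ω a b ≤ M := by
  let S (a b : ℝ) : Set ℝ :=
    {r | ∃ l : List ℝ, l.Pairwise (· ≤ ·) ∧ (∀ x ∈ l, x ∈ Icc a b) ∧ r = csum H l}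
  have hne (a b : ℝ) : (S a b).Nonempty := ⟨0, [], by simp, by simp, by simp⟩
  have hub (a b : ℝ) (ha : A ≤ a) (hb : b ≤ B) : M ∈ upperBounds (S a b) := by
    rintro _ ⟨l, hl, hlm, rfl⟩
    exact hM l hl fun x hx => Icc_subset_Icc ha hb (hlm x hx)
  have hle (a b : ℝ) (ha : A ≤ a) (hb : b ≤ B) (l : List ℝ) (hl : l.Pairwise (· ≤ ·))
      (hlm : ∀ x ∈ l, x ∈ Icc a b) : csum H l ≤ sSup (S a b) :=
    le_csSup ⟨M, hub a b ha hb⟩ ⟨l, hl, hlm, rfl⟩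
  refine ⟨fun a b => sSup (S a b), hle, fun a b c ha hab hbc hc => ?_,
    fun a b ha hb => csSup_le (hne a b) (hub a b ha hb)⟩
  rw [← le_sub_iff_add_le]
  refine csSup_le (hne a b) ?_
  rintro _ ⟨l₁, hl₁, hm₁, rfl⟩
  rw [le_sub_comm]
  refine csSup_le (hne b c) ?_
  rintro _ ⟨l₂, hl₂, hm₂, rfl⟩
  rw [le_sub_iff_add_le']
  refine (csum_add_le_append hH l₁ l₂).trans (hle a c ha hc _ ?_ ?_)
  · exact List.pairwise_append.2
      ⟨hl₁, hl₂, fun x hx y hy => (hm₁ x hx).2.trans (hm₂ y hy).1⟩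
  · intro x hx
    rcases List.mem_append.1 hx with h | h
    · exact ⟨(hm₁ x h).1, (hm₁ x h).2.trans hbc⟩
    · exact ⟨hab.trans (hm₂ x h).1, (hm₂ x h).2⟩

theorem exists_csum_le_of_pVar_lt_top {E : Type*} [NormedAddCommGroup E] {p a b : ℝ} (hp : 0 < p)
    (hab : a ≤ b) {X : ℝ → E} (hX : pVar p X a b < ⊤) :
    ∃ M, ∀ l : List ℝ, l.Pairwise (· ≤ ·) → (∀ x ∈ l, x ∈ Icc a b) →
      csum (fun x y => ‖X y - X x‖ ^ p) l ≤ M := by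
  have hF : ∀ x y, 0 ≤ ‖X y - X x‖ ^ p := fun x y => by positivity
  refine ⟨((pVar p X a b) ^ p).toReal, fun l hl hlm => ?_⟩
  obtain ⟨t, ht⟩ := exists_ofFn_eq a (l ++ [b])
  have hs : (a :: (l ++ [b])).Pairwise (· ≤ ·) := by
    rw [List.pairwise_cons, List.pairwise_append]
    refine ⟨?_, hl, by simp, fun x hx y hy => ?_⟩
    · intro x hx
      rcases List.mem_append.1 hx with h | h
      · exact (hlm x h).1
      · rwa [List.mem_singleton.1 h]
    · rw [List.mem_singleton.1 hy]
      exact (hlm x hx).2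
  have h1 : csum (fun x y => ‖X y - X x‖ ^ p) l ≤
      csum (fun x y => ‖X y - X x‖ ^ p) (a :: (l ++ [b])) := by
    have h2 := csum_add_le_append hF [a] (l ++ [b])
    have h3 := csum_add_le_append hF l [b]
    simp only [csum_singleton, List.singleton_append] at h2 h3
    linarith
  refine h1.trans ?_
  rw [← ht, csum_ofFn]
  rw [← ht] at hs
  have hmono : Monotone t := (List.sortedLE_ofFn_iff).1 hs.sortedLE
  have h0 : t 0 = a := by rw [List.ofFn_succ] at ht; exact (List.cons.inj ht).1
  have hlast : t (Fin.last _) = b := apply_last_of_getLast?_ofFn 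
    (ht ▸ List.getLast?_eq_some_iff.2 ⟨a :: l, rfl⟩)
  have hle : (∑ i : Fin (l ++ [b]).length,
      (‖X (t i.succ) - X (t i.castSucc)‖₊ : ENNReal) ^ p) ^ (1 / p) ≤ pVar p X a b :=
    le_iSup_of_le _ (le_iSup_of_le t (le_iSup_of_le ⟨hmono, h0, hlast⟩ le_rfl))
  rw [one_div, ENNReal.rpow_inv_le_iff hp] at hle
  have := ENNReal.toReal_mono (ENNReal.rpow_ne_top_of_nonneg hp.le hX.ne) hle
  refine le_trans (le_of_eq ?_) this
  rw [ENNReal.toReal_sum fun i _ => ENNReal.rpow_ne_top_of_nonneg hp.le ENNReal.coe_ne_top]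
  refine Finset.sum_congr rfl fun i _ => ?_
  rw [← ENNReal.toReal_rpow]
  simp

theorem exists_taylor_bound_on_compact {E F : Type*} [NormedAddCommGroup E] [NormedSpace ℝ E]
    [NormedAddCommGroup F] [NormedSpace ℝ F] {Φ : E → F} (hΦ : ContDiff ℝ 2 Φ) {K : Set E}
    (hK : IsCompact K) :
    ∃ C : ℝ, 0 ≤ C ∧ ∀ x ∈ K, ∀ y ∈ K, ‖Φ y - Φ x - fderiv ℝ Φ x (y - x)‖ ≤ C * ‖y - x‖ ^ 2 := by
  have hd : ContDiff ℝ 1 (fderiv ℝ Φ) := hΦ.fderiv_right (by norm_num)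
  let N (q : E × E) : ℝ := ‖Φ q.2 - Φ q.1 - fderiv ℝ Φ q.1 (q.2 - q.1)‖
  have hN : Continuous N := by
    have h1 := hΦ.continuous
    have h2 := hd.continuous
    fun_prop
  have key : ∃ C : ℝ, 0 ≤ C ∧ ∀ q ∈ K ×ˢ K, N q ≤ C * ‖q.2 - q.1‖ ^ 2 := by
    refine (hK.prod hK).induction_on (p := fun S => ∃ C : ℝ, 0 ≤ C ∧ ∀ q ∈ S,
      N q ≤ C * ‖q.2 - q.1‖ ^ 2) ⟨0, le_rfl, by simp⟩ ?_ ?_ ?_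
    · rintro S S' hS ⟨C, hC, h⟩
      exact ⟨C, hC, fun q hq => h q (hS hq)⟩
    · rintro S S' ⟨C, hC, h⟩ ⟨C', hC', h'⟩
      refine ⟨C + C', add_nonneg hC hC', fun q hq => ?_⟩
      have : 0 ≤ ‖q.2 - q.1‖ ^ 2 := by positivity
      rcases hq with hq | hq
      · nlinarith [h q hq]
      · nlinarith [h' q hq]
    · rintro ⟨x, y⟩ -
      suffices H : ∃ C : ℝ, 0 ≤ C ∧ ∀ᶠ q in 𝓝 (x, y), N q ≤ C * ‖q.2 - q.1‖ ^ 2 by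
        obtain ⟨C, hC, h⟩ := H
        exact ⟨_, mem_nhdsWithin_of_mem_nhds h, C, hC, fun q hq => hq⟩
      rcases eq_or_ne x y with rfl | hxy
      · obtain ⟨L, t, ht, hL⟩ := (hd.contDiffAt (x := x)).exists_lipschitzOnWith
        obtain ⟨r, hr, hrt⟩ := Metric.mem_nhds_iff.1 ht
        refine ⟨L, L.2, ?_⟩
        filter_upwards [prod_mem_nhds (Metric.ball_mem_nhds x hr) (Metric.ball_mem_nhds x hr)]
        rintro ⟨u, v⟩ ⟨hu, hv⟩
        have hseg : segment ℝ u v ⊆ t := ((convex_ball x r).segment_subset hu hv).trans hrt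
        have := (convex_segment u v).norm_image_sub_le_of_norm_fderiv_le' (𝕜 := ℝ) (f := Φ)
          (φ := fderiv ℝ Φ u) (C := L * ‖v - u‖)
          (fun z _ => (hΦ.differentiable (by norm_num)).differentiableAt)
          (fun z hz => ?_) (left_mem_segment ℝ u v) (right_mem_segment ℝ u v)
        · simpa [N, sq, mul_assoc] using this
        · refine (hL.norm_sub_le (hseg hz) (hrt hu)).trans ?_
          gcongr
          obtain ⟨θ, ⟨h0, h1⟩, rfl⟩ := (segment_eq_image' ℝ u v ▸ hz :)
          rw [add_sub_cancel_left, norm_smul, Real.norm_eq_abs, abs_of_nonneg h0]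
          exact mul_le_of_le_one_left (norm_nonneg _) h1
      · have hpos : 0 < ‖y - x‖ ^ 2 := by
          have := sub_ne_zero.2 hxy.symm
          positivity
        refine ⟨(N (x, y) + 1) / (‖y - x‖ ^ 2 / 2), by positivity, ?_⟩
        have hc : Continuous fun q : E × E => ‖q.2 - q.1‖ ^ 2 := by fun_prop
        filter_upwards [hN.continuousAt.eventually_lt_const (lt_add_one (N (x, y))),
          hc.continuousAt.eventually_const_lt (half_lt_self hpos)] with q h1 h2
        rw [div_mul_eq_mul_div, le_div_iff₀ (by positivity)]
        exact mul_le_mul h1.le h2.le (by positivity) (by positivity)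
  obtain ⟨C, hC, h⟩ := key
  exact ⟨C, hC, fun x hx y hy => h (x, y) ⟨hx, hy⟩⟩

theorem pVar_comp_lt_top {E F : Type*} [NormedAddCommGroup E] [NormedAddCommGroup F] {p a b : ℝ}
    (hp : 0 < p) {Y : ℝ → E} (hY : pVar p Y a b < ⊤) {Φ : E → F} {L : NNReal}
    (hΦ : LipschitzOnWith L Φ (Y '' Icc a b)) : pVar p (fun t => Φ (Y t)) a b < ⊤ := by
  refine lt_of_le_of_lt ?_ (ENNReal.mul_lt_top (ENNReal.coe_lt_top (r := L)) hY)
  refine iSup_le fun k => iSup_le fun t => iSup_le fun ht => ?_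
  have hmem (i : Fin (k + 1)) : t i ∈ Icc a b :=
    ⟨ht.2.1 ▸ ht.1 (Fin.zero_le i), ht.2.2 ▸ ht.1 (Fin.le_last i)⟩
  calc (∑ i : Fin k, (‖Φ (Y (t i.succ)) - Φ (Y (t i.castSucc))‖₊ : ENNReal) ^ p) ^ (1 / p)
      ≤ (∑ i : Fin k, (L * (‖Y (t i.succ) - Y (t i.castSucc)‖₊ : ENNReal)) ^ p) ^ (1 / p) := by
        gcongr with i
        have := hΦ.norm_sub_le (mem_image_of_mem Y (hmem i.succ))
          (mem_image_of_mem Y (hmem i.castSucc))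
        exact_mod_cast this
    _ = L * (∑ i : Fin k, (‖Y (t i.succ) - Y (t i.castSucc)‖₊ : ENNReal) ^ p) ^ (1 / p) := by
        simp_rw [ENNReal.mul_rpow_of_nonneg _ _ hp.le]
        rw [← Finset.mul_sum, ENNReal.mul_rpow_of_nonneg _ _ (by positivity), ← ENNReal.rpow_mul,
          mul_one_div_cancel hp.ne', ENNReal.rpow_one]
    _ ≤ _ := by
        gcongr
        exact le_iSup_of_le k (le_iSup_of_le t (le_iSup_of_le ht le_rfl))

theorem rpow_mul_le_of_le {u v η γ p θ : ℝ} (hu : 0 ≤ u) (hv : 0 ≤ v) (huη : u ≤ η) (hvη : v ≤ η)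
    (hγ : 0 ≤ γ) (hp : 0 < p) (hθ : 0 < θ) (hpθ : p * θ < 1 + γ) :
    u ^ γ * v ≤ η ^ (1 + γ - p * θ) * (u ^ p + v ^ p) ^ θ := by
  set m := max u v
  have hm0 : 0 ≤ m := hu.trans (le_max_left _ _)
  have hpθ0 : 0 < p * θ := by positivity
  calc u ^ γ * v ≤ m ^ γ * m := by
        gcongr
        exacts [le_max_left _ _, le_max_right _ _]
    _ = m ^ (1 + γ - p * θ) * (m ^ p) ^ θ := by
        rw [← Real.rpow_mul hm0, ← Real.rpow_add_of_nonneg hm0 (by linarith) hpθ0.le,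
          sub_add_cancel, Real.rpow_add_of_nonneg hm0 zero_le_one hγ, Real.rpow_one, mul_comm]
    _ ≤ η ^ (1 + γ - p * θ) * (u ^ p + v ^ p) ^ θ := by
        have h1 : m ^ p ≤ u ^ p + v ^ p := by
          rcases max_cases u v with h | h
          · simp only [m, h.1]; linarith [Real.rpow_nonneg hv p]
          · simp only [m, h.1]; linarith [Real.rpow_nonneg hu p]
        have hmη : m ≤ η := max_le huη hvη
        have hη0 : 0 ≤ η := hm0.trans hmη
        gcongr

theorem exists_uniform_bound {E : Type*} [NormedAddCommGroup E] {T η : ℝ} {X : ℝ → E}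
    (hX : ContinuousOn X (Icc 0 T)) (hη : 0 < η) :
    ∃ δ > 0, ∀ s ∈ Icc (0 : ℝ) T, ∀ t ∈ Icc (0 : ℝ) T, |t - s| ≤ δ → ‖X t - X s‖ ≤ η := by
  obtain ⟨δ, hδ, h⟩ := Metric.uniformContinuousOn_iff.1
    (isCompact_Icc.uniformContinuousOn_of_continuous hX) η hη
  refine ⟨δ / 2, half_pos hδ, fun s hs t ht hst => ?_⟩
  rw [← dist_eq_norm]
  exact (h t ht s hs (by rw [Real.dist_eq]; linarith)).le

/-- If `f ∘ Φ = DΦ · f`, then `Φ` is a symmetry of the Young equation `dY = f(Y)dX`: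
for every solution `Y` starting at `y₀`, the path `Φ ∘ Y` is a solution starting at `Φ(y₀)`,
i.e. `Φ(Y_t) = Φ(y₀) + ∫_0^t f(Φ(Y_s)) dX_s` for all `t ∈ [0,T]`. -/
theorem symmetry_young
    {E₁ E₂ : Type*} [NormedAddCommGroup E₁] [NormedSpace ℝ E₁] [CompleteSpace E₁]
    [NormedAddCommGroup E₂] [NormedSpace ℝ E₂] [CompleteSpace E₂]
    (p γ T : ℝ) (hp1 : 1 ≤ p) (hp2 : p < 2) (hγ0 : 0 < γ) (hγ1 : γ ≤ 1)
    (hγp : 1 + γ > p) (hT : 0 ≤ T)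
    (X : ℝ → E₂) (hX : MemVp p X 0 T)
    (f : E₁ → E₂ →L[ℝ] E₁)
    (hf : ∃ C : ℝ, ∀ x y : E₁, ‖f x - f y‖ ≤ C * ‖x - y‖ ^ γ)
    (Φ : E₁ → E₁) (hΦ : ContDiff ℝ 2 Φ)
    (hsym : ∀ y : E₁, f (Φ y) = (fderiv ℝ Φ y).comp (f y))
    (y₀ : E₁) (Y : ℝ → E₁) (hY0 : Y 0 = y₀) (hY : MemVp p Y 0 T)
    (hYeq : ∀ t ∈ Set.Icc (0 : ℝ) T, IsYoungIntegral (fun s => f (Y s)) X 0 t (Y t - y₀)) :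
    MemVp p (fun t => Φ (Y t)) 0 T ∧
    ∀ t ∈ Set.Icc (0 : ℝ) T,
      IsYoungIntegral (fun s => f (Φ (Y s))) X 0 t (Φ (Y t) - Φ y₀) := by
  have hp0 : 0 < p := by linarith
  have hΦY : ContinuousOn (fun t => Φ (Y t)) (Icc 0 T) := hΦ.continuous.comp_continuousOn hY.1
  have hK : IsCompact (Y '' Icc 0 T) := isCompact_Icc.image_of_continuousOn hY.1
  have hΦ1 : ContDiff ℝ 1 Φ := hΦ.of_le (by norm_num)
  obtain ⟨L₀, hL₀⟩ := hΦ1.locallyLipschitz.locallyLipschitzOn.exists_lipschitzOnWith_of_compact hK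
  refine ⟨⟨hΦY, pVar_comp_lt_top hp0 hY.2 hL₀⟩, fun t ht => ?_⟩
  obtain ⟨C, hC, hTaylor⟩ := exists_taylor_bound_on_compact hΦ hK
  obtain ⟨L, hL⟩ := hK.exists_bound_of_continuousOn
    (hΦ.continuous_fderiv (by norm_num)).continuousOn
  obtain ⟨A, hA0, hA⟩ : ∃ A : ℝ, 0 ≤ A ∧ ∀ x y : E₁, ‖f x - f y‖ ≤ A * ‖x - y‖ ^ γ := by
    obtain ⟨A, hA⟩ := hf
    exact ⟨max A 0, le_max_right _ _, fun x y => (hA x y).trans (by gcongr; exact le_max_left _ _)⟩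
  obtain ⟨MX, hMX⟩ := exists_csum_le_of_pVar_lt_top hp0 hT hX.2
  obtain ⟨MY, hMY⟩ := exists_csum_le_of_pVar_lt_top hp0 hT hY.2
  obtain ⟨ω, hωl, hωadd, hωM⟩ := exists_control
    (H := fun x y => ‖Y y - Y x‖ ^ p + ‖X y - X x‖ ^ p) (A := 0) (B := T) (M := MY + MX)
    (fun x y => by positivity)
    (fun l hl hlm => by rw [csum_add]; exact add_le_add (hMY l hl hlm) (hMX l hl hlm))
  set M := MY + MX
  have hω0 (a b : ℝ) (ha : 0 ≤ a) (hb : b ≤ T) : 0 ≤ ω a b := by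
    simpa using hωl a b ha hb [] (by simp) (by simp)
  have hM0 : 0 ≤ M := (hω0 0 T le_rfl le_rfl).trans (hωM 0 T le_rfl le_rfl)
  have hL0 : 0 ≤ L := (norm_nonneg _).trans (hL (Y 0) (mem_image_of_mem Y ⟨le_rfl, hT⟩))
  obtain ⟨θ, hθ1, hpθ⟩ : ∃ θ : ℝ, 1 < θ ∧ p * θ < 1 + γ := by
    obtain ⟨θ, h1, h2⟩ := exists_between ((one_lt_div hp0).2 hγp)
    exact ⟨θ, h1, by rwa [lt_div_iff₀' hp0] at h2⟩
  set S := ∑' j : ℕ, 1 / ((j : ℝ) + 1) ^ θ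
  have hS0 : 0 ≤ S := tsum_nonneg fun j => by positivity
  have hYoung {η a b : ℝ} (hη : 0 < η) (ha : 0 ≤ a) (hab : a ≤ b) (hb : b ≤ T)
      (hXη : ∀ x ∈ Icc a b, ∀ y ∈ Icc a b, ‖X y - X x‖ ≤ η)
      (hYη : ∀ x ∈ Icc a b, ∀ y ∈ Icc a b, ‖Y y - Y x‖ ≤ η) :
      ‖Y b - Y a - f (Y a) (X b - X a)‖ ≤
        A * η ^ (1 + γ - p * θ) * M ^ (θ - 1) * S * ω a b := by
    have hωab := hω0 a b ha hb
    have h1 : A * η ^ (1 + γ - p * θ) * ω a b ^ θ * S ≤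
        A * η ^ (1 + γ - p * θ) * M ^ (θ - 1) * S * ω a b := by
      have : ω a b ^ θ ≤ M ^ (θ - 1) * ω a b := by
        calc ω a b ^ θ = ω a b ^ (θ - 1) * ω a b := by
              rw [← Real.rpow_add_one' hωab (by linarith), sub_add_cancel]
          _ ≤ _ := by
              gcongr
              exact hωM a b ha hb
      calc _ ≤ A * η ^ (1 + γ - p * θ) * (M ^ (θ - 1) * ω a b) * S := by gcongr
        _ = _ := by ring
    refine le_of_forall_pos_le_add fun ε hε => ?_
    obtain ⟨l, hl, hlast, hlε⟩ := (hYeq a ⟨ha, hab.trans hb⟩).exists_csum_near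
      (hYeq b ⟨ha.trans hab, hb⟩) ha hab hε
    have h2 := norm_riemann_sub_le (Z := fun s => f (Y s)) (X := X)
      (F := fun x y => ‖Y y - Y x‖ ^ p) (F' := fun x y => ‖X y - X x‖ ^ p)
      (A := A * η ^ (1 + γ - p * θ)) (V := ω a b) (s := a) (t := b) hθ1 (by positivity)
      (fun x y => by positivity) (fun x y => by positivity)
      (fun x y z hx hy hz => by
        refine ((f (Y y) - f (Y x)).le_opNorm _).trans ?_
        calc _ ≤ A * ‖Y y - Y x‖ ^ γ * ‖X z - X y‖ := by gcongr; exact hA _ _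
          _ = A * (‖Y y - Y x‖ ^ γ * ‖X z - X y‖) := mul_assoc _ _ _
          _ ≤ A * (η ^ (1 + γ - p * θ) * (‖Y y - Y x‖ ^ p + ‖X z - X y‖ ^ p) ^ θ) := by
            refine mul_le_mul_of_nonneg_left ?_ hA0
            exact rpow_mul_le_of_le (norm_nonneg _) (norm_nonneg _) (hYη x hx y hy)
              (hXη y hy z hz) hγ0.le hp0 (by linarith) hpθ
          _ = _ := (mul_assoc _ _ _).symm)
      (fun l hl hlm => by rw [← csum_add]; exact hωl a b ha hb l hl hlm)
      hl (mem_Icc_of_mem_cons hl hlast) (List.head?_cons) hlast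
    set R := csum (fun x y => f (Y x) (X y - X x)) (a :: l)
    calc ‖Y b - Y a - f (Y a) (X b - X a)‖
        = ‖(R - f (Y a) (X b - X a)) - (R - (Y b - y₀ - (Y a - y₀)))‖ := by congr 1; abel
      _ ≤ _ := (norm_sub_le _ _).trans (add_le_add (h2.trans h1) hlε)
  let κ (η : ℝ) : ℝ := C * η ^ (2 - p) + L * (A * η ^ (1 + γ - p * θ) * M ^ (θ - 1) * S)
  have hκ : Tendsto (fun η => κ η * M) (𝓝[>] 0) (𝓝 0) := by
    have h1 : ContinuousAt (fun η : ℝ => η ^ (2 - p)) 0 :=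
      Real.continuousAt_rpow_const _ _ (Or.inr (by linarith))
    have h2 : ContinuousAt (fun η : ℝ => η ^ (1 + γ - p * θ)) 0 :=
      Real.continuousAt_rpow_const _ _ (Or.inr (by linarith))
    have h3 : ContinuousAt (fun η => κ η * M) 0 := by fun_prop
    have h4 : κ 0 * M = 0 := by
      simp only [κ]
      rw [Real.zero_rpow (by linarith), Real.zero_rpow (by linarith)]
      ring
    have := h3.tendsto
    rw [h4] at this
    exact this.mono_left nhdsWithin_le_nhds
  rw [isYoungIntegral_iff_csum]
  intro ε hε
  obtain ⟨η, hκη, hη⟩ := ((hκ.eventually_lt_const hε).and self_mem_nhdsWithin).exists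
  have hη : 0 < η := hη
  have hκ0 : 0 ≤ κ η := by positivity
  obtain ⟨δX, hδX, hXη⟩ := exists_uniform_bound hX.1 hη
  obtain ⟨δY, hδY, hYη⟩ := exists_uniform_bound hY.1 hη
  refine ⟨min δX δY, lt_min hδX hδY, fun l hl hlast => ?_⟩
  have hstep (a b : ℝ) (ha : 0 ≤ a) (hb : b ≤ T) (hab : MeshStep (min δX δY) a b) :
      ‖f (Φ (Y a)) (X b - X a) - (Φ (Y b) - Φ (Y a))‖ ≤ κ η * ω a b := by
    obtain ⟨hab, hδ⟩ := hab
    have hsub {x : ℝ} (hx : x ∈ Icc a b) : x ∈ Icc 0 T := Icc_subset_Icc ha hb hx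
    have hdist {x y : ℝ} (hx : x ∈ Icc a b) (hy : y ∈ Icc a b) : |y - x| ≤ min δX δY :=
      (abs_sub_le_of_le_of_le hy.1 hy.2 hx.1 hx.2).trans hδ
    have hma := left_mem_Icc.2 hab
    have hmb := right_mem_Icc.2 hab
    have h1 := hYoung hη ha hab hb
      (fun x hx y hy => hXη x (hsub hx) y (hsub hy) ((hdist hx hy).trans (min_le_left _ _)))
      (fun x hx y hy => hYη x (hsub hx) y (hsub hy) ((hdist hx hy).trans (min_le_right _ _)))
    have h2 := hTaylor (Y a) (mem_image_of_mem Y (hsub hma)) (Y b) (mem_image_of_mem Y (hsub hmb))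
    have h3 : ‖Y b - Y a‖ ^ 2 ≤ η ^ (2 - p) * ω a b := by
      have h4 : ‖Y b - Y a‖ ^ p ≤ ω a b := by
        have := hωl a b ha hb [a, b] (by simpa using hab) (by simp [hab])
        simp only [csum_cons_cons, csum_singleton, add_zero] at this
        have h5 : 0 ≤ ‖X b - X a‖ ^ p := by positivity
        linarith
      have h6 : ‖Y b - Y a‖ ≤ η :=
        hYη a (hsub hma) b (hsub hmb) ((hdist hma hmb).trans (min_le_right _ _))
      calc ‖Y b - Y a‖ ^ 2 = ‖Y b - Y a‖ ^ (2 - p) * ‖Y b - Y a‖ ^ p := by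
            rw [← Real.rpow_add_of_nonneg (norm_nonneg _) (by linarith) hp0.le, sub_add_cancel,
              Real.rpow_two]
        _ ≤ _ := by
            gcongr
    calc ‖f (Φ (Y a)) (X b - X a) - (Φ (Y b) - Φ (Y a))‖
        = ‖(Φ (Y b) - Φ (Y a) - fderiv ℝ Φ (Y a) (Y b - Y a)) +
            fderiv ℝ Φ (Y a) (Y b - Y a - f (Y a) (X b - X a))‖ := by
          rw [hsym, ContinuousLinearMap.comp_apply, map_sub (fderiv ℝ Φ (Y a)) (Y b - Y a),
            norm_sub_rev]
          congr 1; abel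
      _ ≤ C * (η ^ (2 - p) * ω a b) +
            L * (A * η ^ (1 + γ - p * θ) * M ^ (θ - 1) * S * ω a b) := by
          refine (norm_add_le _ _).trans (add_le_add (h2.trans (by gcongr)) ?_)
          refine ((fderiv ℝ Φ (Y a)).le_opNorm _).trans ?_
          gcongr
          exact hL _ (mem_image_of_mem Y (hsub hma))
      _ = κ η * ω a b := by simp only [κ]; ring
  have hfinal := (norm_csum_sub_le (F := fun x y => f (Φ (Y x)) (X y - X x))
    (h := fun s => Φ (Y s)) (ω := fun a b => κ η * ω a b) (A := 0) (B := T)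
    (fun a ha => mul_nonneg hκ0 (hω0 a a ha.1 ha.2))
    (fun a b c ha hab hbc hc => by
      rw [← mul_add]
      exact mul_le_mul_of_nonneg_left (hωadd a b c ha hab hbc hc) hκ0)
    (fun _ _ h => h.1) hstep hl hlast le_rfl ht.2).2
  rw [hY0] at hfinal
  calc _ ≤ κ η * ω 0 t := hfinal
    _ ≤ κ η * M := mul_le_mul_of_nonneg_left (hωM 0 t le_rfl ht.2) hκ0
    _ < ε := hκη
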